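/- Let r1, r2, r3, r4 be real numbers and write ri* = 1 + r1 − ri for i = 2,3,4. Assume that none of r1/2, r2*, r3*, r4*, (1 + r1)/2, and 1 + r1 is a nonpositive integer, that 1 + r1 − r3 − r4 > 0, and that 2 + 2·r1 − 2·(r2 + r3 + r4) > 0 (so that both series below converge absolutely). Then the very well-poised hypergeometric series satisfies: 5F4(r1, 1 + r1/2, r2, r3, r4; r1/2, r2*, r3*, r4*; −1) = [Γ(r3*)·Γ(r4*) / (Γ(1 + r1)·Γ(r4* − r3))] · 3F2((1 + r1)/2 − r2, r3, r4; (1 + r1)/2, r2*; 1). -/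

import Mathlib

open Real

/-- Ascending Pochhammer symbol `(x)_k = x(x+1)⋯(x+k−1)`. -/
noncomputable def poch (x : ℝ) (k : ℕ) : ℝ := (ascPochhammer ℝ k).eval x

/-- Generalized hypergeometric series `₅F₄(a₁,…,a₅; b₁,…,b₄; z)`. -/
noncomputable def F54 (a1 a2 a3 a4 a5 b1 b2 b3 b4 z : ℝ) : ℝ :=
  ∑' k : ℕ, (poch a1 k * poch a2 k * poch a3 k * poch a4 k * poch a5 k)
      / (poch b1 k * poch b2 k * poch b3 k * poch b4 k * (k.factorial : ℝ)) * z ^ k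

/-- Generalized hypergeometric series `₃F₂(a₁,a₂,a₃; b₁,b₂; z)`. -/
noncomputable def F32 (a1 a2 a3 b1 b2 z : ℝ) : ℝ :=
  ∑' k : ℕ, (poch a1 k * poch a2 k * poch a3 k)
      / (poch b1 k * poch b2 k * (k.factorial : ℝ)) * z ^ k


section

open Filter Topology Asymptotics

lemma poch_zero (x : ℝ) : poch x 0 = 1 := by simp [poch]

lemma poch_succ (x : ℝ) (k : ℕ) : poch x (k + 1) = poch x k * (x + k) :=
  ascPochhammer_succ_eval k x

lemma poch_add (x : ℝ) (m n : ℕ) : poch x (m + n) = poch x m * poch (x + m) n := by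
  induction n with
  | zero => simp [poch_zero]
  | succ n ih =>
    rw [← add_assoc, poch_succ, ih, poch_succ]
    push_cast
    ring

lemma poch_succ_left (x : ℝ) (k : ℕ) : poch x (k + 1) = x * poch (x + 1) k := by
  rw [add_comm k 1, poch_add, poch_succ, poch_zero]
  simp

lemma poch_one (k : ℕ) : poch 1 k = k.factorial := by simp [poch]

lemma poch_eq_prod (x : ℝ) (k : ℕ) : poch x k = ∏ j ∈ Finset.range k, (x + j) := by
  induction k with
  | zero => simp [poch_zero]
  | succ k ih => rw [poch_succ, ih, Finset.prod_range_succ]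

lemma poch_ne_zero {x : ℝ} (hx : ∀ n : ℕ, x ≠ -(n : ℝ)) (k : ℕ) : poch x k ≠ 0 := by
  rw [poch_eq_prod, Finset.prod_ne_zero_iff]
  exact fun j _ h => hx j (eq_neg_of_add_eq_zero_left h)

lemma poch_pos {x : ℝ} (hx : 0 < x) (k : ℕ) : 0 < poch x k := by
  rw [poch_eq_prod]
  exact Finset.prod_pos fun j _ => by positivity

lemma poch_le_poch {x y : ℝ} (hx : 0 < x) (hxy : x ≤ y) (k : ℕ) : poch x k ≤ poch y k := by
  rw [poch_eq_prod, poch_eq_prod]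
  exact Finset.prod_le_prod (fun j _ => by positivity) fun j _ => by linarith

lemma add_natCast_ne_neg {x : ℝ} (hx : ∀ n : ℕ, x ≠ -(n : ℝ)) (m n : ℕ) :
    x + m ≠ -(n : ℝ) := fun h => hx (m + n) (by push_cast; linarith)

lemma Gamma_add_natCast {x : ℝ} (hx : ∀ n : ℕ, x ≠ -(n : ℝ)) (k : ℕ) :
    Gamma (x + k) = poch x k * Gamma x := by
  induction k with
  | zero => simp [poch_zero]
  | succ k ih =>
    have h : x + k ≠ 0 := fun h => hx k (eq_neg_of_add_eq_zero_left h)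
    push_cast
    rw [← add_assoc, Gamma_add_one h, ih, poch_succ]
    ring

lemma GammaSeq_eq (x : ℝ) (n : ℕ) :
    GammaSeq x n = (n : ℝ) ^ x * n.factorial / poch x (n + 1) := by
  rw [GammaSeq, poch_eq_prod]

lemma poch_eq_zero_of_le {n k : ℕ} (h : n < k) : poch (-(n : ℝ)) k = 0 := by
  rw [poch_eq_prod]
  exact Finset.prod_eq_zero (Finset.mem_range.mpr h) (by simp)

lemma isBigO_poch_succ (x : ℝ) :
    (fun n : ℕ => poch x (n + 1)) =O[atTop] fun n : ℕ => (n : ℝ) ^ x * n.factorial := by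
  by_cases hx : ∀ n : ℕ, x ≠ -(n : ℝ)
  · have h := ((GammaSeq_tendsto_Gamma x).inv₀ (Gamma_ne_zero hx)).isBigO_one ℝ
    refine ((h.mul (isBigO_refl (fun n : ℕ => (n : ℝ) ^ x * n.factorial) atTop)).congr' ?_ ?_)
    · filter_upwards [eventually_gt_atTop 0] with n hn
      have : (0 : ℝ) < n := by exact_mod_cast hn
      have h2 := poch_ne_zero hx (n + 1)
      rw [GammaSeq_eq]
      field_simp
    · simp
  · push Not at hx
    obtain ⟨m, rfl⟩ := hx
    refine (isBigO_zero _ _).congr' ?_ EventuallyEq.rfl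
    filter_upwards [eventually_ge_atTop m] with n hn
    exact (poch_eq_zero_of_le (by omega)).symm

lemma isBigO_inv_poch_succ (x : ℝ) :
    (fun n : ℕ => (poch x (n + 1))⁻¹) =O[atTop]
      fun n : ℕ => (n : ℝ) ^ (-x) * (n.factorial : ℝ)⁻¹ := by
  have h := (GammaSeq_tendsto_Gamma x).isBigO_one ℝ
  refine ((h.mul
    (isBigO_refl (fun n : ℕ => (n : ℝ) ^ (-x) * (n.factorial : ℝ)⁻¹) atTop)).congr' ?_ ?_)
  · filter_upwards [eventually_gt_atTop 0] with n hn
    have : (0 : ℝ) < n := by exact_mod_cast hn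
    rw [GammaSeq_eq, rpow_neg this.le]
    have := rpow_pos_of_pos this x
    field_simp
  · simp

/-- The general term of Gauss's series `₂F₁(a, b; c; 1)`. -/
noncomputable def gaussTerm (a b c : ℝ) (k : ℕ) : ℝ :=
  poch a k * poch b k / (poch c k * k.factorial)

lemma isBigO_gaussTerm_succ (a b c : ℝ) :
    (fun n : ℕ => gaussTerm a b c (n + 1)) =O[atTop] fun n : ℕ => (n : ℝ) ^ (a + b - c - 1) := by
  refine (((isBigO_poch_succ a).mul (isBigO_poch_succ b)).mul
    ((isBigO_inv_poch_succ c).mul (isBigO_inv_poch_succ 1))).congr' ?_ ?_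
  · refine Eventually.of_forall fun n => ?_
    simp only [gaussTerm, poch_one, div_eq_mul_inv, mul_inv]
  · filter_upwards [eventually_gt_atTop 0] with n hn
    have hn' : (0 : ℝ) < n := by exact_mod_cast hn
    rw [show a + b - c - 1 = a + (b + (-c + -1)) by ring, rpow_add hn', rpow_add hn', rpow_add hn']
    field_simp

lemma summable_gaussTerm {a b c : ℝ} (h : 0 < c - a - b) : Summable (gaussTerm a b c) :=
  (summable_nat_add_iff 1).mp <|
    summable_of_isBigO_nat (summable_nat_rpow.mpr (by linarith)) (isBigO_gaussTerm_succ a b c)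

lemma tendsto_natCast_mul_gaussTerm {a b c : ℝ} (h : 0 < c - a - b) :
    Tendsto (fun k : ℕ => (k : ℝ) * gaussTerm a b c k) atTop (𝓝 0) := by
  rw [← tendsto_add_atTop_iff_nat 1]
  have h1 : (fun n : ℕ => ((n + 1 : ℕ) : ℝ)) =O[atTop] fun n : ℕ => (n : ℝ) := by
    refine IsBigO.of_bound 2 ?_
    filter_upwards [eventually_gt_atTop 0] with n hn
    have hn' : (1 : ℝ) ≤ n := by exact_mod_cast hn
    rw [norm_of_nonneg (by positivity), norm_of_nonneg (by positivity)]
    push_cast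
    linarith
  refine (h1.mul (isBigO_gaussTerm_succ a b c)).trans_tendsto ?_
  refine ((tendsto_rpow_neg_atTop h).comp tendsto_natCast_atTop_atTop).congr' ?_
  filter_upwards [eventually_gt_atTop 0] with n hn
  have hn' : (0 : ℝ) < n := by exact_mod_cast hn
  simp only [Function.comp]
  rw [show -(c - a - b) = 1 + (a + b - c - 1) by ring, rpow_add hn', rpow_one]

lemma tsum_gaussTerm_contiguous {a b c : ℝ} (hc : ∀ n : ℕ, c ≠ -(n : ℝ)) (h : 0 < c - a - b) :
    ∑' k, gaussTerm a b c k =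
      (c - a) * (c - b) / (c * (c - a - b)) * ∑' k, gaussTerm a b (c + 1) k := by
  have hc0 : c ≠ 0 := by simpa using hc 0
  have key (k : ℕ) : (c - a - b) * gaussTerm a b c k
      - (c - a) * (c - b) / c * gaussTerm a b (c + 1) k =
      -(((k + 1 : ℕ) : ℝ) * gaussTerm a b c (k + 1) - (k : ℝ) * gaussTerm a b c k) := by
    have hck : c + k ≠ 0 := fun h => hc k (eq_neg_of_add_eq_zero_left h)
    have hp := poch_ne_zero hc k
    have hs : poch (c + 1) k = poch c k * (c + k) / c := by
      rw [eq_div_iff hc0, ← poch_succ, poch_succ_left, mul_comm]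
    have hf : (k.factorial : ℝ) ≠ 0 := by positivity
    have hk : (k : ℝ) + 1 ≠ 0 := by positivity
    simp only [gaussTerm, poch_succ, hs, Nat.factorial_succ]
    push_cast
    field_simp
    ring
  have hs := ((summable_gaussTerm h).hasSum.mul_left (c - a - b)).sub
    ((summable_gaussTerm (a := a) (b := b) (c := c + 1) (by linarith)).hasSum.mul_left
      ((c - a) * (c - b) / c))
  have ht := hs.tendsto_sum_nat
  simp only [key, Finset.sum_neg_distrib] at ht
  simp only [Finset.sum_range_sub (fun k : ℕ => (k : ℝ) * gaussTerm a b c k)] at ht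
  have h0 := tendsto_nhds_unique ht ((tendsto_natCast_mul_gaussTerm h).sub_const _).neg
  simp only [Nat.cast_zero, zero_mul, sub_zero, neg_zero] at h0
  have : (c - a - b) ≠ 0 := h.ne'
  field_simp at h0 ⊢
  linarith

lemma tsum_gaussTerm_shift {a b c : ℝ} (hc : ∀ n : ℕ, c ≠ -(n : ℝ)) (h : 0 < c - a - b) (m : ℕ) :
    ∑' k, gaussTerm a b c k =
      poch (c - a) m * poch (c - b) m / (poch c m * poch (c - a - b) m) *
        ∑' k, gaussTerm a b (c + m) k := by
  induction m with
  | zero => simp [poch_zero]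
  | succ m ih =>
    have hm : (0 : ℝ) ≤ m := m.cast_nonneg
    rw [ih, tsum_gaussTerm_contiguous (add_natCast_ne_neg hc m) (by linarith)]
    simp only [poch_succ]
    push_cast
    rw [show c + m - a = c - a + m by ring, show c + m - b = c - b + m by ring,
      show c - a + m - b = c - a - b + m by ring, ← add_assoc, ← mul_assoc, div_mul_div_comm]
    congr 2 <;> ring

lemma tendsto_tsum_gaussTerm {a b c : ℝ} (h : 0 < c - a - b) :
    Tendsto (fun m : ℕ => ∑' k, gaussTerm a b (c + m) k) atTop (𝓝 1) := by
  obtain ⟨M, hM⟩ := exists_nat_gt (-c)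
  have hM0 : (0 : ℝ) ≤ M := M.cast_nonneg
  have h1 : ∑' k : ℕ, (if k = 0 then (1 : ℝ) else 0) = 1 := by simp
  rw [← h1]
  refine tendsto_tsum_of_dominated_convergence
    (bound := fun k => ‖gaussTerm a b (c + M) k‖) (summable_gaussTerm (by linarith)).norm ?_ ?_
  · intro k
    rcases k with _ | k
    · simp [gaussTerm, poch_zero]
    · have hp : Tendsto (fun x : ℝ => poch x (k + 1)) atTop atTop := by
        refine Polynomial.tendsto_atTop_of_leadingCoeff_nonneg _ ?_ ?_
        · rw [Polynomial.degree_eq_natDegree (monic_ascPochhammer ℝ _).ne_zero,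
            ascPochhammer_natDegree]
          exact_mod_cast k.succ_pos
        · rw [(monic_ascPochhammer ℝ _).leadingCoeff]
          exact zero_le_one
      have hm := hp.comp (tendsto_atTop_add_const_left atTop c tendsto_natCast_atTop_atTop)
      have hm' := (hm.atTop_mul_const
        (show (0 : ℝ) < (k + 1).factorial by positivity)).inv_tendsto_atTop.const_mul
          (poch a (k + 1) * poch b (k + 1))
      simpa [gaussTerm, div_eq_mul_inv] using hm'
  · filter_upwards [eventually_ge_atTop M] with m hm k
    have hm' : (M : ℝ) ≤ m := by exact_mod_cast hm
    have h0 : 0 < c + M := by linarith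
    have hp := poch_pos h0 k
    have hle := poch_le_poch h0 (show c + M ≤ c + m by linarith) k
    rw [gaussTerm, gaussTerm, norm_div, norm_div]
    have hp' := hp.trans_le hle
    rw [norm_of_nonneg (show 0 ≤ poch (c + m) k * k.factorial by positivity),
      norm_of_nonneg (show 0 ≤ poch (c + M) k * k.factorial by positivity)]
    gcongr

/-- Gauss's summation theorem for `₂F₁(a, b; c; 1)`. -/
lemma tsum_gaussTerm {a b c : ℝ} (hc : ∀ n : ℕ, c ≠ -(n : ℝ)) (h : 0 < c - a - b)
    (ha : ∀ n : ℕ, c - a ≠ -(n : ℝ)) (hb : ∀ n : ℕ, c - b ≠ -(n : ℝ)) :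
    ∑' k, gaussTerm a b c k =
      Gamma c * Gamma (c - a - b) / (Gamma (c - a) * Gamma (c - b)) := by
  have hG := ((GammaSeq_tendsto_Gamma c).mul (GammaSeq_tendsto_Gamma (c - a - b))).div
    ((GammaSeq_tendsto_Gamma (c - a)).mul (GammaSeq_tendsto_Gamma (c - b)))
    (mul_ne_zero (Gamma_ne_zero ha) (Gamma_ne_zero hb))
  have hP := hG.mul ((tendsto_add_atTop_iff_nat 1).mpr (tendsto_tsum_gaussTerm h))
  rw [mul_one] at hP
  refine tendsto_nhds_unique (tendsto_const_nhds.congr' ?_) hP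
  filter_upwards [eventually_gt_atTop 0] with n hn
  have hn' : (0 : ℝ) < n := by exact_mod_cast hn
  rw [tsum_gaussTerm_shift hc h (n + 1)]
  congr 1
  simp only [Pi.div_apply, GammaSeq_eq]
  have hpow : (n : ℝ) ^ (c - a) * (n : ℝ) ^ (c - b) = (n : ℝ) ^ c * (n : ℝ) ^ (c - a - b) := by
    rw [← rpow_add hn', ← rpow_add hn']
    ring_nf
  have h1 := poch_ne_zero ha (n + 1)
  have h2 := poch_ne_zero hb (n + 1)
  have h3 := poch_ne_zero hc (n + 1)
  have h4 := (poch_pos h (n + 1)).ne'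
  have h5 := rpow_pos_of_pos hn' (c - a)
  have h6 := rpow_pos_of_pos hn' (c - b)
  have h7 := rpow_pos_of_pos hn' c
  have h8 := rpow_pos_of_pos hn' (c - a - b)
  have h9 : (0 : ℝ) < n.factorial := by positivity
  rw [div_mul_div_comm, div_mul_div_comm, div_div_div_eq,
    div_eq_div_iff (by positivity) (by positivity)]
  linear_combination (-(poch (c - a) (n + 1) * poch (c - b) (n + 1) * poch c (n + 1) *
    poch (c - a - b) (n + 1) * (n.factorial : ℝ) ^ 2)) * -hpow

/-- The general term of the very well-poised series
`₄F₃(a, 1 + a/2, b; a/2, 1 + a - b; -1)`. -/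
noncomputable def veryWellPoisedTerm (a b : ℝ) (k : ℕ) : ℝ :=
  poch a k * poch (1 + a / 2) k * poch b k / (poch (a / 2) k * poch (1 + a - b) k * k.factorial)
    * (-1) ^ k

/-- The general term of the well-poised series `₂F₁(a, b; 1 + a - b; -1)`. -/
noncomputable def wellPoisedTerm (a b : ℝ) (k : ℕ) : ℝ :=
  poch a k * poch b k / (poch (1 + a - b) k * k.factorial) * (-1) ^ k

lemma veryWellPoisedTerm_eq {a : ℝ} (b : ℝ) (ha : ∀ n : ℕ, a / 2 ≠ -(n : ℝ)) (k : ℕ) :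
    veryWellPoisedTerm a b k = (a + 2 * k) / a * wellPoisedTerm a b k := by
  have ha0 : a ≠ 0 := fun h => ha 0 (by simp [h])
  have h0 := poch_ne_zero ha k
  have h : poch (1 + a / 2) k = (a + 2 * k) / a * poch (a / 2) k := by
    have h1 := poch_succ_left (a / 2) k
    rw [poch_succ, add_comm (a / 2) 1] at h1
    field_simp at h1 ⊢
    linarith
  rw [veryWellPoisedTerm, wellPoisedTerm, h]
  field_simp

lemma wellPoisedTerm_succ {a b : ℝ} (hb : ∀ n : ℕ, 1 + a - b ≠ -(n : ℝ)) (k : ℕ) :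
    wellPoisedTerm a b (k + 1) =
      -((a + k) * (b + k) / ((1 + a - b + k) * (k + 1)) * wellPoisedTerm a b k) := by
  have h0 := poch_ne_zero hb k
  have h1 : 1 + a - b + k ≠ 0 := fun h => hb k (eq_neg_of_add_eq_zero_left h)
  have h2 : (k : ℝ) + 1 ≠ 0 := by positivity
  have h3 : (k.factorial : ℝ) ≠ 0 := by positivity
  simp only [wellPoisedTerm, poch_succ, Nat.factorial_succ, pow_succ]
  push_cast
  field_simp

lemma veryWellPoisedTerm_telescope {a b : ℝ} (ha : ∀ n : ℕ, a / 2 ≠ -(n : ℝ))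
    (hb : ∀ n : ℕ, 1 + a - b ≠ -(n : ℝ)) (ha1 : ∀ n : ℕ, 1 + a ≠ -(n : ℝ)) {n r : ℕ}
    (hr : r ≤ n) :
    (n + 1) * (1 + a - b + n) * (1 + a + 2 * n) *
        (veryWellPoisedTerm a b r / ((n + 1 - r).factorial * poch (1 + a) (n + 1 + r)))
      - (1 + a - 2 * b + 2 * n) *
        (veryWellPoisedTerm a b r / ((n - r).factorial * poch (1 + a) (n + r))) =
    -((a + 2 * (r + 1 : ℕ) - 1) * (r + 1 : ℕ) * (a - b + (r + 1 : ℕ)) *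
        wellPoisedTerm a b (r + 1) /
          (a * ((n + 1 - (r + 1)).factorial * poch (1 + a) (n + (r + 1)))))
      - -((a + 2 * r - 1) * r * (a - b + r) * wellPoisedTerm a b r /
          (a * ((n + 1 - r).factorial * poch (1 + a) (n + r)))) := by
  obtain ⟨p, rfl⟩ := Nat.exists_eq_add_of_le hr
  have ha0 : a ≠ 0 := fun h => ha 0 (by simp [h])
  rw [show r + p + 1 - r = p + 1 by omega, show r + p - r = p by omega,
    show r + p + 1 - (r + 1) = p by omega, show r + p + 1 + r = r + p + r + 1 by omega,
    show r + p + (r + 1) = r + p + r + 1 by omega, veryWellPoisedTerm_eq b ha,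
    wellPoisedTerm_succ hb, poch_succ, Nat.factorial_succ]
  have h0 := poch_ne_zero ha1 (r + p + r)
  have h1 : 1 + a - b + r ≠ 0 := fun h => hb r (eq_neg_of_add_eq_zero_left h)
  have h2 : (r : ℝ) + 1 ≠ 0 := by positivity
  have h3 : (p.factorial : ℝ) ≠ 0 := by positivity
  have h4 : 1 + a + ((r + p + r : ℕ) : ℝ) ≠ 0 :=
    fun h => ha1 (r + p + r) (eq_neg_of_add_eq_zero_left h)
  have h5 : (p : ℝ) + 1 ≠ 0 := by positivity
  push_cast at h4 ⊢
  have h6 : a - b + (r + 1) = 1 + a - b + r := by ring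
  rw [h6]
  field_simp
  ring

/-- Summation of a terminating very well-poised `₄F₃(1)`. -/
lemma sum_veryWellPoisedTerm {a b : ℝ} (ha : ∀ n : ℕ, a / 2 ≠ -(n : ℝ))
    (hb : ∀ n : ℕ, 1 + a - b ≠ -(n : ℝ)) (ha1 : ∀ n : ℕ, 1 + a ≠ -(n : ℝ))
    (ha2 : ∀ n : ℕ, (1 + a) / 2 ≠ -(n : ℝ)) (n : ℕ) :
    ∑ r ∈ Finset.range (n + 1),
        veryWellPoisedTerm a b r / ((n - r).factorial * poch (1 + a) (n + r)) =
      poch ((1 + a) / 2 - b) n / (poch ((1 + a) / 2) n * poch (1 + a - b) n * n.factorial) := by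
  induction n with
  | zero => simp [veryWellPoisedTerm, poch_zero]
  | succ n ih =>
    have ha0 : a ≠ 0 := fun h => ha 0 (by simp [h])
    have htel := Finset.sum_congr rfl fun r hr => veryWellPoisedTerm_telescope (n := n) ha hb ha1
      (Nat.lt_succ_iff.mp (Finset.mem_range.mp hr))
    rw [Finset.sum_range_sub (fun r : ℕ => -((a + 2 * r - 1) * r * (a - b + r) *
      wellPoisedTerm a b r / (a * ((n + 1 - r).factorial * poch (1 + a) (n + r))))),
      Finset.sum_sub_distrib, ← Finset.mul_sum, ← Finset.mul_sum, ih] at htel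
    have h0 := poch_ne_zero ha1 (n + (n + 1))
    have h1 : 1 + a - b + n ≠ 0 := fun h => hb n (eq_neg_of_add_eq_zero_left h)
    have h2 : (n : ℝ) + 1 ≠ 0 := by positivity
    have h3 : (1 + a) / 2 + n ≠ 0 := fun h => ha2 n (eq_neg_of_add_eq_zero_left h)
    have h4 : 1 + a + ((n + (n + 1) : ℕ) : ℝ) ≠ 0 :=
      fun h => ha1 (n + (n + 1)) (eq_neg_of_add_eq_zero_left h)
    have h5 : 1 + a + 2 * (n : ℝ) ≠ 0 := fun h => h3 (by linarith)
    have hlast : (n + 1) * (1 + a - b + n) * (1 + a + 2 * n) *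
        (veryWellPoisedTerm a b (n + 1) /
          ((n + 1 - (n + 1)).factorial * poch (1 + a) (n + 1 + (n + 1)))) =
        (a + 2 * (n + 1 : ℕ) - 1) * (n + 1 : ℕ) * (a - b + (n + 1 : ℕ)) *
          wellPoisedTerm a b (n + 1) /
          (a * ((n + 1 - (n + 1)).factorial * poch (1 + a) (n + (n + 1)))) := by
      rw [veryWellPoisedTerm_eq b ha, show n + 1 + (n + 1) = n + (n + 1) + 1 by omega, poch_succ]
      simp only [Nat.sub_self, Nat.factorial_zero]
      push_cast at h4 ⊢
      field_simp
      ring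
    have hrec : (n + 1) * (1 + a - b + n) * (1 + a + 2 * n) *
        ∑ r ∈ Finset.range (n + 1 + 1),
          veryWellPoisedTerm a b r / ((n + 1 - r).factorial * poch (1 + a) (n + 1 + r)) =
        (1 + a - 2 * b + 2 * n) * (poch ((1 + a) / 2 - b) n /
          (poch ((1 + a) / 2) n * poch (1 + a - b) n * n.factorial)) := by
      rw [Finset.sum_range_succ, mul_add, hlast]
      simp only [Nat.cast_zero, mul_zero, zero_mul, zero_div, neg_zero, sub_zero] at htel
      linear_combination htel
    have hK : (n + 1) * (1 + a - b + n) * (1 + a + 2 * n) ≠ 0 := by positivity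
    refine mul_left_cancel₀ hK (hrec.trans ?_)
    have h6 := poch_ne_zero ha2 n
    have h7 := poch_ne_zero hb n
    have h8 : (n.factorial : ℝ) ≠ 0 := by positivity
    simp only [poch_succ, Nat.factorial_succ]
    push_cast
    field_simp

lemma summable_veryWellPoisedTerm_mul {a b d e : ℝ}
    (h : 0 < 2 + 2 * a - 2 * (b + d + e)) :
    Summable fun n => veryWellPoisedTerm a b n *
      (poch d n * poch e n / (poch (1 + a - d) n * poch (1 + a - e) n)) := by
  refine (summable_nat_add_iff 1).mp <| summable_of_isBigO_nat
    (g := fun n : ℕ => (n : ℝ) ^ (2 * (b + d + e) - 2 * a - 3))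
    (summable_nat_rpow.mpr (by linarith)) ?_
  have hsign : (fun n : ℕ => (-1 : ℝ) ^ (n + 1)) =O[atTop] fun _ : ℕ => (1 : ℝ) :=
    IsBigO.of_bound 1 (by simp)
  have H := ((((isBigO_poch_succ a).mul (isBigO_poch_succ (1 + a / 2))).mul
    ((isBigO_poch_succ b).mul ((isBigO_poch_succ d).mul (isBigO_poch_succ e)))).mul
    (((isBigO_inv_poch_succ (a / 2)).mul (isBigO_inv_poch_succ (1 + a - b))).mul
      ((isBigO_inv_poch_succ 1).mul
        ((isBigO_inv_poch_succ (1 + a - d)).mul (isBigO_inv_poch_succ (1 + a - e)))))).mul hsign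
  refine H.congr' ?_ ?_
  · refine Eventually.of_forall fun n => ?_
    simp only [veryWellPoisedTerm, poch_one, div_eq_mul_inv, mul_inv]
    ring
  · filter_upwards [eventually_gt_atTop 0] with n hn
    have hn' : (0 : ℝ) < n := by exact_mod_cast hn
    have hexp : (n : ℝ) ^ (2 * (b + d + e) - 2 * a - 3) =
        (n : ℝ) ^ a * (n : ℝ) ^ (1 + a / 2) * ((n : ℝ) ^ b * ((n : ℝ) ^ d * (n : ℝ) ^ e)) *
        ((n : ℝ) ^ (-(a / 2)) * (n : ℝ) ^ (-(1 + a - b)) * ((n : ℝ) ^ (-1 : ℝ) *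
          ((n : ℝ) ^ (-(1 + a - d)) * (n : ℝ) ^ (-(1 + a - e))))) := by
      simp only [← rpow_add hn']
      ring_nf
    have hf : (n.factorial : ℝ) ≠ 0 := by positivity
    rw [hexp]
    field_simp

/-- The terms of the double series whose row sums give the very well-poised series and whose
antidiagonal sums give Whipple's `₃F₂(1)`. -/
noncomputable def whippleTerm (a b d e : ℝ) (p : ℕ × ℕ) : ℝ :=
  veryWellPoisedTerm a b p.1 * (poch d (p.1 + p.2) * poch e (p.1 + p.2)) /
    (p.2.factorial * poch (1 + a) (p.1 + p.2 + p.1))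

lemma whippleTerm_eq (a b d e : ℝ) (n j : ℕ) :
    whippleTerm a b d e (n, j) =
      veryWellPoisedTerm a b n * (poch d n * poch e n) / poch (1 + a) (n + n) *
        gaussTerm (d + n) (e + n) (1 + a + (n + n : ℕ)) j := by
  rw [whippleTerm, gaussTerm, show n + j + n = n + n + j by omega]
  simp only [poch_add]
  rw [div_mul_div_comm]
  congr 1 <;> ring

lemma tsum_whippleTerm_row {a b d e : ℝ} (ha1 : ∀ n : ℕ, 1 + a ≠ -(n : ℝ))
    (hd : ∀ n : ℕ, 1 + a - d ≠ -(n : ℝ)) (he : ∀ n : ℕ, 1 + a - e ≠ -(n : ℝ))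
    (hde : 0 < 1 + a - d - e) (n : ℕ) :
    ∑' j, whippleTerm a b d e (n, j) =
      Gamma (1 + a) * Gamma (1 + a - d - e) / (Gamma (1 + a - d) * Gamma (1 + a - e)) *
      (veryWellPoisedTerm a b n *
        (poch d n * poch e n / (poch (1 + a - d) n * poch (1 + a - e) n))) := by
  have hd' : 1 + a + (n + n : ℕ) - (d + n) = 1 + a - d + n := by push_cast; ring
  have he' : 1 + a + (n + n : ℕ) - (e + n) = 1 + a - e + n := by push_cast; ring
  have hde' : 1 + a - d + n - (e + n) = 1 + a - d - e := by ring
  simp only [whippleTerm_eq]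
  rw [tsum_mul_left, tsum_gaussTerm (add_natCast_ne_neg ha1 _) (by rw [hd', hde']; exact hde)
    (by rw [hd']; exact add_natCast_ne_neg hd n) (by rw [he']; exact add_natCast_ne_neg he n),
    hd', he', hde', Gamma_add_natCast ha1, Gamma_add_natCast hd, Gamma_add_natCast he]
  have h0 := poch_ne_zero ha1 (n + n)
  have h1 := poch_ne_zero hd n
  have h2 := poch_ne_zero he n
  have h3 := Gamma_ne_zero hd
  have h4 := Gamma_ne_zero he
  field_simp

lemma summable_whippleTerm {a b d e : ℝ} (ha1 : ∀ n : ℕ, 1 + a ≠ -(n : ℝ))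
    (hd : ∀ n : ℕ, 1 + a - d ≠ -(n : ℝ)) (he : ∀ n : ℕ, 1 + a - e ≠ -(n : ℝ))
    (hde : 0 < 1 + a - d - e) (h : 0 < 2 + 2 * a - 2 * (b + d + e)) :
    Summable (whippleTerm a b d e) := by
  rw [← summable_norm_iff, summable_prod_of_nonneg fun p => norm_nonneg _]
  constructor
  · intro n
    simp only [whippleTerm_eq]
    refine Summable.norm (Summable.mul_left _ (summable_gaussTerm ?_))
    push_cast
    linarith
  · have hs := ((summable_veryWellPoisedTerm_mul h).mul_left
      (Gamma (1 + a) * Gamma (1 + a - d - e) / (Gamma (1 + a - d) * Gamma (1 + a - e)))).norm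
    refine hs.congr_atTop ?_
    obtain ⟨N₁, h₁⟩ := exists_nat_gt (-d)
    obtain ⟨N₂, h₂⟩ := exists_nat_gt (-e)
    obtain ⟨N₃, h₃⟩ := exists_nat_gt (-(1 + a))
    filter_upwards [eventually_ge_atTop N₁, eventually_ge_atTop N₂, eventually_ge_atTop N₃]
      with n hn₁ hn₂ hn₃
    have hn₁' : (N₁ : ℝ) ≤ n := by exact_mod_cast hn₁
    have hn₂' : (N₂ : ℝ) ≤ n := by exact_mod_cast hn₂
    have hn₃' : (N₃ : ℝ) ≤ n := by exact_mod_cast hn₃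
    have hn₀ : (0 : ℝ) ≤ n := n.cast_nonneg
    have hpos (j : ℕ) : 0 ≤ gaussTerm (d + n) (e + n) (1 + a + (n + n : ℕ)) j := by
      have p1 := poch_pos (show 0 < d + n by linarith) j
      have p2 := poch_pos (show 0 < e + n by linarith) j
      have p3 := poch_pos (show 0 < 1 + a + (n + n : ℕ) by push_cast; linarith) j
      rw [gaussTerm]
      positivity
    rw [← tsum_whippleTerm_row ha1 hd he hde n]
    simp only [whippleTerm_eq, norm_mul, tsum_mul_left]
    congr 1
    simp only [norm_of_nonneg (hpos _), norm_of_nonneg (tsum_nonneg hpos)]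

lemma sum_whippleTerm_antidiagonal {a b : ℝ} (d e : ℝ) (ha : ∀ n : ℕ, a / 2 ≠ -(n : ℝ))
    (hb : ∀ n : ℕ, 1 + a - b ≠ -(n : ℝ)) (ha1 : ∀ n : ℕ, 1 + a ≠ -(n : ℝ))
    (ha2 : ∀ n : ℕ, (1 + a) / 2 ≠ -(n : ℝ)) (n : ℕ) :
    ∑ p ∈ Finset.HasAntidiagonal.antidiagonal n, whippleTerm a b d e p =
      poch ((1 + a) / 2 - b) n * poch d n * poch e n /
        (poch ((1 + a) / 2) n * poch (1 + a - b) n * n.factorial) := by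
  rw [Finset.Nat.sum_antidiagonal_eq_sum_range_succ_mk, mul_assoc, ← div_mul_eq_mul_div,
    ← sum_veryWellPoisedTerm ha hb ha1 ha2, Finset.sum_mul]
  refine Finset.sum_congr rfl fun r hr => ?_
  have hr' : r + (n - r) = n := by have := Finset.mem_range.mp hr; omega
  simp only [whippleTerm, hr']
  ring

end

/-- Whipple's reduction formula for a very well-poised `₅F₄(−1)`. -/
theorem whipple_veryWellPoised_5F4
    (r1 r2 r3 r4 : ℝ)
    (h1 : ∀ n : ℕ, r1 / 2 ≠ -(n : ℝ))
    (h2 : ∀ n : ℕ, 1 + r1 - r2 ≠ -(n : ℝ))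
    (h3 : ∀ n : ℕ, 1 + r1 - r3 ≠ -(n : ℝ))
    (h4 : ∀ n : ℕ, 1 + r1 - r4 ≠ -(n : ℝ))
    (h5 : ∀ n : ℕ, (1 + r1) / 2 ≠ -(n : ℝ))
    (h6 : ∀ n : ℕ, 1 + r1 ≠ -(n : ℝ))
    (hconv1 : 0 < 1 + r1 - r3 - r4)
    (hconv2 : 0 < 2 + 2 * r1 - 2 * (r2 + r3 + r4)) :
    F54 r1 (1 + r1 / 2) r2 r3 r4 (r1 / 2) (1 + r1 - r2) (1 + r1 - r3) (1 + r1 - r4) (-1)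
      = Gamma (1 + r1 - r3) * Gamma (1 + r1 - r4)
          / (Gamma (1 + r1) * Gamma ((1 + r1 - r4) - r3))
        * F32 ((1 + r1) / 2 - r2) r3 r4 ((1 + r1) / 2) (1 + r1 - r2) 1 := by
  have hsum := summable_whippleTerm h6 h3 h4 hconv1 hconv2
  have hrows := hsum.tsum_prod
  simp only [tsum_whippleTerm_row h6 h3 h4 hconv1, tsum_mul_left] at hrows
  have hdiag : ∑' p, whippleTerm r1 r2 r3 r4 p =
      ∑' n, ∑ p ∈ Finset.HasAntidiagonal.antidiagonal n, whippleTerm r1 r2 r3 r4 p := by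
    rw [← Finset.HasAntidiagonal.sigmaAntidiagonalEquivProd.tsum_eq (whippleTerm r1 r2 r3 r4)]
    refine (Summable.tsum_sigma' (fun n => (hasSum_fintype _).summable)
        (Finset.HasAntidiagonal.sigmaAntidiagonalEquivProd.summable_iff.mpr hsum)).trans
      (tsum_congr fun n => ?_)
    rw [tsum_fintype]
    exact Finset.sum_coe_sort _ (whippleTerm r1 r2 r3 r4)
  simp only [sum_whippleTerm_antidiagonal r3 r4 h1 h2 h6 h5] at hdiag
  have hF54 : F54 r1 (1 + r1 / 2) r2 r3 r4 (r1 / 2) (1 + r1 - r2) (1 + r1 - r3) (1 + r1 - r4) (-1)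
      = ∑' n, veryWellPoisedTerm r1 r2 n *
        (poch r3 n * poch r4 n / (poch (1 + r1 - r3) n * poch (1 + r1 - r4) n)) := by
    refine tsum_congr fun n => ?_
    simp only [veryWellPoisedTerm, div_eq_mul_inv, mul_inv]
    ring
  have hF32 : F32 ((1 + r1) / 2 - r2) r3 r4 ((1 + r1) / 2) (1 + r1 - r2) 1 =
      ∑' n : ℕ, poch ((1 + r1) / 2 - r2) n * poch r3 n * poch r4 n /
        (poch ((1 + r1) / 2) n * poch (1 + r1 - r2) n * n.factorial) :=
    tsum_congr fun n => by rw [one_pow, mul_one]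
  have g1 := Gamma_ne_zero h6
  have g2 := Gamma_ne_zero h3
  have g3 := Gamma_ne_zero h4
  have g4 := (Gamma_pos_of_pos hconv1).ne'
  rw [hF54, hF32, ← hdiag, hrows, show 1 + r1 - r4 - r3 = 1 + r1 - r3 - r4 by ring]
  field_simp
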